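/- Consider the polynomial ring over k in the variables Y_{i,m} (1 ≤ i ≤ r, 0 ≤ m ≤ a_i) and Z_j (r < j ≤ n), and let Φ be the k-algebra homomorphism from this polynomial ring to P sending Y_{i,m} to the element of P whose i-th component is x^{a_i+1+m} and whose other components are 0, and sending Z_j to h_j. For 1 ≤ i ≤ r and 0 ≤ m ≤ 2a_i set H_i(m) := Y_{i,m} if m ≤ a_i and H_i(m) := Y_{i,m−a_i−1}·Y_{i,0} if a_i+1 ≤ m ≤ 2a_i. Then the image of Φ is A(h̄), and the kernel of Φ is the ideal generated by the following elements: (R1) Y_{i,m}·Y_{i',m'} for i ≠ i' ≤ r, 0 ≤ m ≤ a_i, 0 ≤ m' ≤ a_{i'}; (R2) Y_{i,m}·Y_{i,m'} − H_i(m+m')·Y_{i,0} for i ≤ r, 0 ≤ m, m' ≤ a_i; (R3) Y_{i,m}·Z_j − Σ_{p=1}^{a_i} c_{j,i}(p)·H_i(m+p) for i ≤ r, 0 ≤ m ≤ a_i, r < j ≤ n; (R4) Z_j·Z_{j'} − Σ_{i=1}^r Σ_{1 ≤ p, p' ≤ a_i, p+p' ≥ a_i+1} c_{j,i}(p)·c_{j',i}(p')·H_i(p+p'−a_i−1)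 for r < j < j' ≤ n. -/

import Mathlib

open Polynomial

/-- The polynomial `(h̄_j)_i = Σ_{p=1}^{a_i} c_{j,i}(p)·x^p`. -/
noncomputable def hbarPoly (k : Type*) [Field k] {n : ℕ} (a : Fin n → ℕ)
    (c : Fin n → Fin n → ℕ → k) (j i : Fin n) : Polynomial k :=
  ∑ p ∈ Finset.Icc 1 (a i), Polynomial.C (c j i p) * Polynomial.X ^ p

/-- The subspace `I ⊆ P = ∏_{i=1}^n k[x_i]` of tuples whose `i`-th component is
divisible by `x_i^{a_i+1}` for `i ≤ r` and vanishes for `i > r`. -/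
def ISet (k : Type*) [Field k] {n : ℕ} (r : ℕ) (a : Fin n → ℕ) :
    Set (Fin n → Polynomial k) :=
  {f | (∀ i : Fin n, (i : ℕ) < r → Polynomial.X ^ (a i + 1) ∣ f i) ∧
    ∀ i : Fin n, r ≤ (i : ℕ) → f i = 0}

/-- The subalgebra-as-a-set `B = k·𝟙 + I ⊆ P`. -/
def BSet (k : Type*) [Field k] {n : ℕ} (r : ℕ) (a : Fin n → ℕ) :
    Set (Fin n → Polynomial k) :=
  {f | ∃ (cst : k) (g : Fin n → Polynomial k), g ∈ ISet k r a ∧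
    f = cst • (1 : Fin n → Polynomial k) + g}

/-- The element `h_j ∈ P` with `j`-th component `x_j`, `i`-th component `(h̄_j)_i`
for `i ≤ r`, and remaining components `0`. -/
noncomputable def hElt (k : Type*) [Field k] {n : ℕ} (r : ℕ) (a : Fin n → ℕ)
    (c : Fin n → Fin n → ℕ → k) (j : Fin n) : Fin n → Polynomial k :=
  fun i => if (i : ℕ) < r then hbarPoly k a c j i
    else if i = j then Polynomial.X else 0

/-- The algebra `A(h̄) ⊆ P`: the `k`-subalgebra generated by `B` and the `h_j`. -/
noncomputable def Ahbar (k : Type*) [Field k] {n : ℕ} (r : ℕ) (a : Fin n → ℕ)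
    (c : Fin n → Fin n → ℕ → k) : Subalgebra k (Fin n → Polynomial k) :=
  Algebra.adjoin k
    (BSet k r a ∪ {x | ∃ j : Fin n, r ≤ (j : ℕ) ∧ x = hElt k r a c j})

/-- Index type for the variables `Y_{i,m}` (`i ≤ r`, `0 ≤ m ≤ a_i`) and
`Z_j` (`j > r`). -/
def VIdx (n r : ℕ) (a : Fin n → ℕ) : Type :=
  {p : Fin n × ℕ // ((p.1 : ℕ) < r ∧ p.2 ≤ a p.1)} ⊕ {j : Fin n // r ≤ (j : ℕ)}

/-- The variable `Y_{i,m}`. -/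
noncomputable def Yv (k : Type*) [Field k] {n : ℕ} (r : ℕ) (a : Fin n → ℕ) (i : Fin n) (m : ℕ)
    (h : (i : ℕ) < r ∧ m ≤ a i) : MvPolynomial (VIdx n r a) k :=
  MvPolynomial.X (Sum.inl ⟨(i, m), h⟩)

/-- The variable `Z_j`. -/
noncomputable def Zv (k : Type*) [Field k] {n : ℕ} (r : ℕ) (a : Fin n → ℕ) (j : Fin n)
    (h : r ≤ (j : ℕ)) : MvPolynomial (VIdx n r a) k :=
  MvPolynomial.X (Sum.inr ⟨j, h⟩)

/-- The element `H_i(m)` for `0 ≤ m ≤ 2a_i`: `Y_{i,m}` when `m ≤ a_i`, and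
`Y_{i,m−a_i−1}·Y_{i,0}` when `a_i+1 ≤ m ≤ 2a_i`. -/
noncomputable def Hmon (k : Type*) [Field k] {n : ℕ} (r : ℕ) (a : Fin n → ℕ)
    (i : Fin n) (m : ℕ) (hi : (i : ℕ) < r) (hm : m ≤ 2 * a i) :
    MvPolynomial (VIdx n r a) k :=
  if h : m ≤ a i then Yv k r a i m ⟨hi, h⟩
  else Yv k r a i (m - a i - 1) ⟨hi, by omega⟩ * Yv k r a i 0 ⟨hi, Nat.zero_le _⟩

/-- The evaluation map `Φ` sending `Y_{i,m}` to the tuple with `i`-th component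
`x^{a_i+1+m}` (other components `0`) and `Z_j` to `h_j`. -/
noncomputable def PhiMap (k : Type*) [Field k] {n : ℕ} (r : ℕ) (a : Fin n → ℕ)
    (c : Fin n → Fin n → ℕ → k) :
    MvPolynomial (VIdx n r a) k →ₐ[k] (Fin n → Polynomial k) :=
  MvPolynomial.aeval fun v =>
    match v with
    | Sum.inl ⟨(i, m), _⟩ =>
        (Pi.single i (Polynomial.X ^ (a i + 1 + m)) : Fin n → Polynomial k)
    | Sum.inr ⟨j, _⟩ => hElt k r a c j

/-- The relations (R1): `Y_{i,m}·Y_{i',m'}` for `i ≠ i'`. -/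
def Rel1 (k : Type*) [Field k] {n : ℕ} (r : ℕ) (a : Fin n → ℕ) :
    Set (MvPolynomial (VIdx n r a) k) :=
  {x | ∃ (i i' : Fin n) (m m' : ℕ) (hi : (i : ℕ) < r ∧ m ≤ a i)
    (hi' : (i' : ℕ) < r ∧ m' ≤ a i'), i ≠ i' ∧
      x = Yv k r a i m hi * Yv k r a i' m' hi'}

/-- The relations (R2): `Y_{i,m}·Y_{i,m'} − H_i(m+m')·Y_{i,0}`. -/
noncomputable def Rel2 (k : Type*) [Field k] {n : ℕ} (r : ℕ) (a : Fin n → ℕ) :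
    Set (MvPolynomial (VIdx n r a) k) :=
  {x | ∃ (i : Fin n) (m m' : ℕ) (hi : (i : ℕ) < r) (hm : m ≤ a i)
    (hm' : m' ≤ a i),
      x = Yv k r a i m ⟨hi, hm⟩ * Yv k r a i m' ⟨hi, hm'⟩ -
        Hmon k r a i (m + m') hi (by omega) * Yv k r a i 0 ⟨hi, Nat.zero_le _⟩}

/-- The relations (R3): `Y_{i,m}·Z_j − Σ_{p=1}^{a_i} c_{j,i}(p)·H_i(m+p)`. -/
noncomputable def Rel3 (k : Type*) [Field k] {n : ℕ} (r : ℕ) (a : Fin n → ℕ)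
    (c : Fin n → Fin n → ℕ → k) : Set (MvPolynomial (VIdx n r a) k) :=
  {x | ∃ (i : Fin n) (m : ℕ) (j : Fin n) (hi : (i : ℕ) < r) (hm : m ≤ a i)
    (hj : r ≤ (j : ℕ)),
      x = Yv k r a i m ⟨hi, hm⟩ * Zv k r a j hj -
        ∑ p ∈ (Finset.Icc 1 (a i)).attach,
          MvPolynomial.C (c j i p.1) *
            Hmon k r a i (m + p.1) hi
              (by have := Finset.mem_Icc.mp p.2; omega)}

/-- The relations (R4):
`Z_j·Z_{j'} − Σ_i Σ_{p+p' ≥ a_i+1} c_{j,i}(p)·c_{j',i}(p')·H_i(p+p'−a_i−1)`. -/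
noncomputable def Rel4 (k : Type*) [Field k] {n : ℕ} (r : ℕ) (a : Fin n → ℕ)
    (c : Fin n → Fin n → ℕ → k) : Set (MvPolynomial (VIdx n r a) k) :=
  {x | ∃ (j j' : Fin n) (hj : r ≤ (j : ℕ)) (hj' : r ≤ (j' : ℕ)),
    (j : ℕ) < (j' : ℕ) ∧
      x = Zv k r a j hj * Zv k r a j' hj' -
        ∑ i ∈ (Finset.univ.filter fun i : Fin n => (i : ℕ) < r).attach,
          ∑ p ∈ (Finset.Icc 1 (a i.1)).attach,
            ∑ p' ∈ (Finset.Icc 1 (a i.1)).attach,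
              if h : a i.1 + 1 ≤ p.1 + p'.1 then
                MvPolynomial.C (c j i.1 p.1) * MvPolynomial.C (c j' i.1 p'.1) *
                  Hmon k r a i.1 (p.1 + p'.1 - a i.1 - 1)
                    ((Finset.mem_filter.mp i.2).2)
                    (by
                      have h1 := Finset.mem_Icc.mp p.2
                      have h2 := Finset.mem_Icc.mp p'.2
                      omega)
              else 0}
section SpecialCurve

variable {k : Type*} [Field k] {n r : ℕ} {a : Fin n → ℕ} {c : Fin n → Fin n → ℕ → k}

/-- The monomial in the `Y_{i,m}` whose image under `Φ` is `x_i^{a_i+1+N}`. -/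
noncomputable def yMonomial (k : Type*) [Field k] {n r : ℕ} {a : Fin n → ℕ} {i : Fin n}
    (hi : (i : ℕ) < r) (N : ℕ) : MvPolynomial (VIdx n r a) k :=
  Yv k r a i (N % (a i + 1)) ⟨hi, Nat.le_of_lt_succ (Nat.mod_lt N (Nat.succ_pos (a i)))⟩ *
    Yv k r a i 0 ⟨hi, Nat.zero_le _⟩ ^ (N / (a i + 1))

/-- The normal monomials other than `1`, indexed by a component and a degree. -/
noncomputable def normalMonomial (k : Type*) [Field k] {n : ℕ} (r : ℕ) (a : Fin n → ℕ)
    (i : Fin n) (N : ℕ) : MvPolynomial (VIdx n r a) k :=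
  if hi : (i : ℕ) < r then yMonomial k hi N else Zv k r a i (not_lt.mp hi) ^ (N + 1)

/-- The ideal generated by the relations (R1)–(R4). -/
noncomputable def relIdeal (k : Type*) [Field k] {n : ℕ} (r : ℕ) (a : Fin n → ℕ)
    (c : Fin n → Fin n → ℕ → k) : Ideal (MvPolynomial (VIdx n r a) k) :=
  Ideal.span (Rel1 k r a ∪ Rel2 k r a ∪ Rel3 k r a c ∪ Rel4 k r a c)

/-- The combination of normal monomials with prescribed coefficients, grouped by component. -/
noncomputable def normalSum (k : Type*) [Field k] {n : ℕ} (r : ℕ) (a : Fin n → ℕ)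
    (i : Fin n) : k[X] →ₗ[k] MvPolynomial (VIdx n r a) k :=
  (Polynomial.basisMonomials k).constr k (normalMonomial k r a i)

/-! ### Monomials in the `Y` variables -/

theorem Yv_eq_yMonomial {i : Fin n} {m : ℕ} (hi : (i : ℕ) < r) (hm : m ≤ a i) :
    Yv k r a i m ⟨hi, hm⟩ = yMonomial k hi m := by
  have h1 : m % (a i + 1) = m := Nat.mod_eq_of_lt (by omega)
  have h2 : m / (a i + 1) = 0 := Nat.div_eq_of_lt (by omega)
  simp only [yMonomial, h1, h2, pow_zero, mul_one]

theorem yMonomial_add_mul {i : Fin n} (hi : (i : ℕ) < r) (m e : ℕ) :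
    yMonomial (a := a) k hi (m + (a i + 1) * e) =
      yMonomial k hi m * Yv k r a i 0 ⟨hi, Nat.zero_le _⟩ ^ e := by
  have h1 : (m + (a i + 1) * e) % (a i + 1) = m % (a i + 1) := Nat.add_mul_mod_self_left ..
  have h2 : (m + (a i + 1) * e) / (a i + 1) = m / (a i + 1) + e :=
    Nat.add_mul_div_left _ _ (Nat.succ_pos _)
  simp only [yMonomial, h1, h2, pow_add, mul_assoc]

theorem Hmon_eq_yMonomial {i : Fin n} {m : ℕ} (hi : (i : ℕ) < r) (hm : m ≤ 2 * a i) :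
    Hmon k r a i m hi hm = yMonomial k hi m := by
  unfold Hmon
  split_ifs with h
  · exact Yv_eq_yMonomial hi h
  · have hm' : m = (m - a i - 1) + (a i + 1) * 1 := by omega
    conv_rhs => rw [hm']
    rw [yMonomial_add_mul, pow_one, ← Yv_eq_yMonomial hi (by omega)]

theorem exists_eq_add_mul (b N : ℕ) : ∃ m e, m ≤ b ∧ N = m + (b + 1) * e :=
  ⟨N % (b + 1), N / (b + 1), Nat.le_of_lt_succ (Nat.mod_lt N (Nat.succ_pos b)),
    (Nat.mod_add_div N (b + 1)).symm⟩

/-! ### Values of `Φ` -/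

@[simp]
theorem PhiMap_Yv {i : Fin n} {m : ℕ} (h : (i : ℕ) < r ∧ m ≤ a i) :
    PhiMap k r a c (Yv k r a i m h) = Pi.single i (X ^ (a i + 1 + m)) := by
  exact MvPolynomial.aeval_X _ _

@[simp]
theorem PhiMap_Zv {j : Fin n} (h : r ≤ (j : ℕ)) :
    PhiMap k r a c (Zv k r a j h) = hElt k r a c j := by
  exact MvPolynomial.aeval_X _ _

@[simp]
theorem PhiMap_yMonomial {i : Fin n} (hi : (i : ℕ) < r) (N : ℕ) :
    PhiMap k r a c (yMonomial k hi N) = Pi.single i (X ^ (a i + 1 + N)) := by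
  obtain ⟨m, e, hm, rfl⟩ := exists_eq_add_mul (a i) N
  rw [yMonomial_add_mul, ← Yv_eq_yMonomial hi hm, map_mul, map_pow, PhiMap_Yv, PhiMap_Yv]
  funext l
  obtain rfl | hl := eq_or_ne l i
  · simp only [Pi.mul_apply, Pi.pow_apply, Pi.single_eq_same]
    ring
  · simp [hl]

@[simp]
theorem normalSum_monomial (i : Fin n) (N : ℕ) :
    normalSum k r a i (monomial N 1) = normalMonomial k r a i N := by
  simpa only [normalSum, Polynomial.coe_basisMonomials] using
    (Polynomial.basisMonomials k).constr_basis k (normalMonomial k r a i) N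

theorem PhiMap_normalSum_of_lt {i : Fin n} (hi : (i : ℕ) < r) (p : k[X]) :
    PhiMap k r a c (normalSum k r a i p) = Pi.single i (X ^ (a i + 1) * p) := by
  have : (PhiMap k r a c).toLinearMap ∘ₗ normalSum k r a i =
      LinearMap.single k (fun _ : Fin n => k[X]) i ∘ₗ LinearMap.mulLeft k (X ^ (a i + 1)) := by
    refine (Polynomial.basisMonomials k).ext fun N => ?_
    simp only [Polynomial.coe_basisMonomials, LinearMap.comp_apply, AlgHom.toLinearMap_apply,
      normalSum_monomial, normalMonomial, dif_pos hi, PhiMap_yMonomial]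
    simp [pow_add, mul_assoc, ← Polynomial.X_pow_eq_monomial]
  exact LinearMap.congr_fun this p

theorem PhiMap_normalSum_of_le {j : Fin n} (hj : r ≤ (j : ℕ)) (p : k[X]) :
    PhiMap k r a c (normalSum k r a j p) = aeval (hElt k r a c j) (X * p) := by
  have : (PhiMap k r a c).toLinearMap ∘ₗ normalSum k r a j =
      (aeval (hElt k r a c j)).toLinearMap ∘ₗ LinearMap.mulLeft k X := by
    refine (Polynomial.basisMonomials k).ext fun N => ?_
    simp only [Polynomial.coe_basisMonomials, LinearMap.comp_apply, AlgHom.toLinearMap_apply,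
      normalSum_monomial, normalMonomial, dif_neg (not_lt.mpr hj), map_pow, PhiMap_Zv]
    simp [pow_succ', ← Polynomial.X_pow_eq_monomial]
  exact LinearMap.congr_fun this p

theorem PhiMap_normalSum_apply_of_le {l : Fin n} (hl : r ≤ (l : ℕ)) (i : Fin n) (p : k[X]) :
    PhiMap k r a c (normalSum k r a i p) l = if i = l then X * p else 0 := by
  by_cases hi : (i : ℕ) < r
  · have hil : l ≠ i := by rintro rfl; omega
    simp [PhiMap_normalSum_of_lt hi, hil, hil.symm]
  · rw [PhiMap_normalSum_of_le (not_lt.mp hi), Polynomial.aeval_pi_apply]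
    by_cases hil : i = l
    · subst hil
      simp [hElt, hi]
    · simp [hElt, hl, hil, Ne.symm hil]

/-- Coefficients of a normal form with vanishing image under `Φ` vanish. -/
theorem eq_zero_of_PhiMap_normal_eq_zero (hr : 1 ≤ r) (hrn : r ≤ n)
    (ct : k) (p : Fin n → k[X])
    (h : PhiMap k r a c (MvPolynomial.C ct + ∑ i, normalSum k r a i (p i)) = 0) :
    ct = 0 ∧ p = 0 := by
  have hcomp (l : Fin n) :
      C ct + ∑ i, PhiMap k r a c (normalSum k r a i (p i)) l = 0 := by
    have := congrFun h l
    simpa [← MvPolynomial.algebraMap_eq] using this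
  have hhigh (l : Fin n) (hl : r ≤ (l : ℕ)) : p l = 0 := by
    have h1 := hcomp l
    simp only [PhiMap_normalSum_apply_of_le hl, Finset.sum_ite_eq', Finset.mem_univ, if_true]
      at h1
    have h2 : ct = 0 := by simpa using congrArg (Polynomial.eval 0) h1
    simpa [h2] using h1
  have hlow (l : Fin n) (hl : (l : ℕ) < r) : C ct + X ^ (a l + 1) * p l = 0 := by
    have h1 := hcomp l
    rw [Finset.sum_eq_single l] at h1
    · simpa [PhiMap_normalSum_of_lt hl] using h1
    · intro i _ hil
      by_cases hi : (i : ℕ) < r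
      · simp [PhiMap_normalSum_of_lt hi, hil.symm]
      · simp [hhigh i (not_lt.mp hi)]
    · simp
  have hct : ct = 0 := by
    simpa using congrArg (Polynomial.eval 0) (hlow ⟨0, by omega⟩ hr)
  refine ⟨hct, funext fun l => ?_⟩
  by_cases hl : (l : ℕ) < r
  · simpa [hct] using hlow l hl
  · exact hhigh l (not_lt.mp hl)

/-! ### The image of `Φ` -/

theorem PhiMap_range (r : ℕ) (a : Fin n → ℕ) (c : Fin n → Fin n → ℕ → k) :
    (PhiMap k r a c).range = Ahbar k r a c := by
  apply le_antisymm
  · rw [PhiMap, ← Algebra.adjoin_range_eq_range_aeval, Algebra.adjoin_le_iff]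
    rintro _ ⟨⟨⟨i, m⟩, hi⟩ | ⟨j, hj⟩, rfl⟩
    · refine Algebra.subset_adjoin (Or.inl ⟨0, _, ⟨fun l _ => ?_, fun l hl => ?_⟩, by
        rw [zero_smul, zero_add]⟩)
      · obtain rfl | hl := eq_or_ne l i
        · simp [pow_add _ (a l + 1)]
        · simp [hl]
      · have hil : l ≠ i := by rintro rfl; have := hi.1; simp only at this; omega
        simp [hil]
    · exact Algebra.subset_adjoin (Or.inr ⟨j, hj, rfl⟩)
  · rw [Ahbar, Algebra.adjoin_le_iff]
    rintro f (⟨ct, g, ⟨hg1, hg2⟩, rfl⟩ | ⟨j, hj, rfl⟩)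
    · refine add_mem (Subalgebra.smul_mem _ (one_mem _) _) ?_
      rw [← Finset.univ_sum_single g]
      refine sum_mem fun i _ => ?_
      by_cases hi : (i : ℕ) < r
      · obtain ⟨q, hq⟩ := hg1 i hi
        exact ⟨normalSum k r a i q, by
          rw [hq]; exact PhiMap_normalSum_of_lt hi q⟩
      · rw [hg2 i (not_lt.mp hi), Pi.single_zero]
        exact zero_mem _
    · exact ⟨Zv k r a j hj, PhiMap_Zv hj⟩

/-! ### The relations hold in the image -/

theorem sum_filter_eq_hbarPoly_mul {j j' i : Fin n}
    (h : X ^ (a i + 1) ∣ hbarPoly k a c j i * hbarPoly k a c j' i) :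
    (∑ p ∈ Finset.Icc 1 (a i), ∑ p' ∈ Finset.Icc 1 (a i),
      if a i + 1 ≤ p + p' then C (c j i p) * C (c j' i p') * X ^ (p + p') else 0) =
      hbarPoly k a c j i * hbarPoly k a c j' i := by
  have hprod : hbarPoly k a c j i * hbarPoly k a c j' i =
      ∑ p ∈ Finset.Icc 1 (a i), ∑ p' ∈ Finset.Icc 1 (a i),
        C (c j i p) * C (c j' i p') * X ^ (p + p') := by
    simp only [hbarPoly, Finset.sum_mul_sum]
    refine Finset.sum_congr rfl fun p _ => Finset.sum_congr rfl fun p' _ => by ring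
  ext d
  by_cases hd : d < a i + 1
  · rw [Polynomial.X_pow_dvd_iff.mp h d hd]
    simp only [Polynomial.finsetSum_coeff]
    refine Finset.sum_eq_zero fun p _ => Finset.sum_eq_zero fun p' _ => ?_
    split_ifs with hp
    · rw [← C_mul, Polynomial.coeff_C_mul_X_pow, if_neg (by omega)]
    · simp
  · rw [hprod]
    simp only [Polynomial.finsetSum_coeff]
    refine Finset.sum_congr rfl fun p _ => Finset.sum_congr rfl fun p' _ => ?_
    split_ifs with hp
    · rfl
    · rw [← C_mul, Polynomial.coeff_C_mul_X_pow, if_neg (by omega), Polynomial.coeff_zero]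

theorem relation_three_eq {i j : Fin n} {m : ℕ} (hi : (i : ℕ) < r) (hm : m ≤ a i) :
    (∑ p ∈ (Finset.Icc 1 (a i)).attach,
      MvPolynomial.C (c j i p.1) * Hmon k r a i (m + p.1) hi
        (by have := Finset.mem_Icc.mp p.2; omega)) =
      ∑ p ∈ Finset.Icc 1 (a i), c j i p • yMonomial k hi (m + p) := by
  simp only [Hmon_eq_yMonomial, ← MvPolynomial.smul_eq_C_mul]
  exact Finset.sum_attach (Finset.Icc 1 (a i)) fun p => c j i p • yMonomial k hi (m + p)

theorem PhiMap_relation_three {i j : Fin n} {m : ℕ} (hi : (i : ℕ) < r) (hm : m ≤ a i) :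
    PhiMap k r a c (∑ p ∈ Finset.Icc 1 (a i), c j i p • yMonomial k hi (m + p)) =
      Pi.single i (X ^ (a i + 1 + m)) * hElt k r a c j := by
  funext l
  obtain rfl | hl := eq_or_ne l i
  · simp only [map_sum, map_smul, PhiMap_yMonomial, Finset.sum_apply, Pi.smul_apply,
      Pi.single_eq_same, Pi.mul_apply, hElt, hi, if_true, hbarPoly, Finset.mul_sum,
      Polynomial.smul_eq_C_mul]
    exact Finset.sum_congr rfl fun p _ => by ring
  · simp [hl]

theorem relIdeal_le_ker
    (hprod : ∀ j j' : Fin n, r ≤ (j : ℕ) → r ≤ (j' : ℕ) → j ≠ j' →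
      ∀ i : Fin n, (i : ℕ) < r →
        Polynomial.X ^ (a i + 1) ∣ hbarPoly k a c j i * hbarPoly k a c j' i) :
    relIdeal k r a c ≤ RingHom.ker (PhiMap k r a c) := by
  rw [relIdeal, Ideal.span_le]
  rintro x (((⟨i, i', m, m', hi, hi', hii, rfl⟩ | ⟨i, m, m', hi, hm, hm', rfl⟩) |
    ⟨i, m, j, hi, hm, hj, rfl⟩) | ⟨j, j', hj, hj', hjj, rfl⟩)
  · rw [SetLike.mem_coe, RingHom.mem_ker, map_mul, PhiMap_Yv, PhiMap_Yv]
    funext l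
    obtain rfl | hl := eq_or_ne l i
    · simp [hii]
    · simp [hl]
  · rw [SetLike.mem_coe, RingHom.mem_ker, map_sub, sub_eq_zero, Hmon_eq_yMonomial, map_mul,
      map_mul, PhiMap_Yv, PhiMap_Yv, PhiMap_Yv, PhiMap_yMonomial, ← Pi.single_mul,
      ← Pi.single_mul]
    ring_nf
  · rw [SetLike.mem_coe, RingHom.mem_ker, map_sub, sub_eq_zero, relation_three_eq hi hm,
      PhiMap_relation_three hi hm, map_mul, PhiMap_Yv, PhiMap_Zv]
  · rw [SetLike.mem_coe, RingHom.mem_ker, map_sub, sub_eq_zero, map_mul, PhiMap_Zv, PhiMap_Zv]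
    have hne : j ≠ j' := by rintro rfl; omega
    funext l
    simp only [Hmon_eq_yMonomial, map_sum, apply_dite (PhiMap k r a c), map_mul, map_zero,
      PhiMap_yMonomial, ← MvPolynomial.algebraMap_eq, AlgHom.commutes, Finset.sum_apply,
      Pi.mul_apply]
    by_cases hl : (l : ℕ) < r
    · rw [Finset.sum_eq_single ⟨l, by simpa using hl⟩]
      · simp only [hElt, hl, if_true]
        rw [← sum_filter_eq_hbarPoly_mul (hprod j j' hj hj' hne l hl),
          ← Finset.sum_attach (Finset.Icc 1 (a l))]
        refine Finset.sum_congr rfl fun p _ => ?_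
        rw [← Finset.sum_attach (Finset.Icc 1 (a l))]
        refine Finset.sum_congr rfl fun p' _ => ?_
        split_ifs with hp
        · simp only [Pi.mul_apply, Pi.single_eq_same, Pi.algebraMap_apply,
            Polynomial.algebraMap_eq]
          congr 2
          omega
        · rfl
      · intro i _ hil
        have hil' : l ≠ i.1 := fun h => hil (Subtype.ext h.symm)
        refine Finset.sum_eq_zero fun p _ => Finset.sum_eq_zero fun p' _ => ?_
        split_ifs <;> simp [hil']
      · simp
    · rw [Finset.sum_eq_zero]
      · simp only [hElt, hl, if_false]
        split_ifs with h1 h2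
        · exact absurd (h1.symm.trans h2) hne
        all_goals simp
      · intro i _
        have hil' : l ≠ i.1 := by
          intro h
          exact hl (h ▸ (Finset.mem_filter.mp i.2).2)
        refine Finset.sum_eq_zero fun p _ => Finset.sum_eq_zero fun p' _ => ?_
        split_ifs <;> simp [hil']

/-! ### Reduction to normal form modulo the relations -/

local notation "π" => Ideal.Quotient.mkₐ k (relIdeal k r a c)

theorem mk_eq_of_sub_mem {x y : MvPolynomial (VIdx n r a) k}
    (h : x - y ∈ Rel1 k r a ∪ Rel2 k r a ∪ Rel3 k r a c ∪ Rel4 k r a c) : π x = π y :=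
  Ideal.Quotient.eq.mpr (Ideal.subset_span h)

theorem mk_yMonomial_mul_of_ne {i i' : Fin n} (hi : (i : ℕ) < r) (hi' : (i' : ℕ) < r)
    (h : i ≠ i') (M N : ℕ) : π (yMonomial k hi M) * π (yMonomial k hi' N) = 0 := by
  obtain ⟨m, e, hm, rfl⟩ := exists_eq_add_mul (a i) M
  obtain ⟨m', e', hm', rfl⟩ := exists_eq_add_mul (a i') N
  have key : π (yMonomial k hi m * yMonomial k hi' m') = π 0 := by
    refine mk_eq_of_sub_mem (Or.inl (Or.inl (Or.inl ⟨i, i', m, m', ⟨hi, hm⟩, ⟨hi', hm'⟩, h, ?_⟩)))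
    rw [sub_zero, Yv_eq_yMonomial hi hm, Yv_eq_yMonomial hi' hm']
  rw [map_zero, map_mul] at key
  rw [yMonomial_add_mul, yMonomial_add_mul, map_mul, map_mul, mul_mul_mul_comm, key, zero_mul]

theorem mk_yMonomial_mul {i : Fin n} (hi : (i : ℕ) < r) (M N : ℕ) :
    π (yMonomial k hi M) * π (yMonomial k hi N) = π (yMonomial k hi (M + N + (a i + 1))) := by
  obtain ⟨m, e, hm, rfl⟩ := exists_eq_add_mul (a i) M
  obtain ⟨m', e', hm', rfl⟩ := exists_eq_add_mul (a i) N
  have key : π (yMonomial k hi m * yMonomial k hi m') =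
      π (yMonomial k hi (m + m') * Yv k r a i 0 ⟨hi, Nat.zero_le _⟩) := by
    refine mk_eq_of_sub_mem (Or.inl (Or.inl (Or.inr ⟨i, m, m', hi, hm, hm', ?_⟩)))
    rw [Hmon_eq_yMonomial, Yv_eq_yMonomial hi hm, Yv_eq_yMonomial hi hm']
  have hdeg : m + (a i + 1) * e + (m' + (a i + 1) * e') + (a i + 1) =
      m + m' + (a i + 1) * (e + e' + 1) := by ring
  rw [hdeg, yMonomial_add_mul, yMonomial_add_mul, yMonomial_add_mul, map_mul, map_mul,
    mul_mul_mul_comm, ← map_mul, key, ← map_mul, ← map_mul]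
  congr 1
  ring

theorem mk_yMonomial_mul_Zv {i j : Fin n} (hi : (i : ℕ) < r) (hj : r ≤ (j : ℕ)) (N : ℕ) :
    π (yMonomial k hi N) * π (Zv k r a j hj) =
      ∑ p ∈ Finset.Icc 1 (a i), c j i p • π (yMonomial k hi (N + p)) := by
  obtain ⟨m, e, hm, rfl⟩ := exists_eq_add_mul (a i) N
  have key : π (yMonomial k hi m * Zv k r a j hj) =
      π (∑ p ∈ Finset.Icc 1 (a i), c j i p • yMonomial k hi (m + p)) := by
    refine mk_eq_of_sub_mem (Or.inl (Or.inr ⟨i, m, j, hi, hm, hj, ?_⟩))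
    rw [relation_three_eq hi hm, Yv_eq_yMonomial hi hm]
  rw [yMonomial_add_mul, map_mul, mul_right_comm, ← map_mul, key, map_sum, Finset.sum_mul]
  refine Finset.sum_congr rfl fun p _ => ?_
  rw [add_right_comm m _ p, yMonomial_add_mul, map_mul, map_smul, smul_mul_assoc]

variable (k r a c) in
/-- The span of the monomials in the `Y` variables, modulo the relations. -/
noncomputable def ySpan : Submodule k (MvPolynomial (VIdx n r a) k ⧸ relIdeal k r a c) :=
  Submodule.span k {x | ∃ (i : Fin n) (hi : (i : ℕ) < r) (N : ℕ), x = π (yMonomial k hi N)}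

variable (k r a c) in
/-- The span of the normal monomials, modulo the relations. -/
noncomputable def normalSpan : Submodule k (MvPolynomial (VIdx n r a) k ⧸ relIdeal k r a c) :=
  Submodule.span k (insert 1 {x | ∃ (i : Fin n) (N : ℕ), x = π (normalMonomial k r a i N)})

theorem mk_yMonomial_mem_ySpan {i : Fin n} (hi : (i : ℕ) < r) (N : ℕ) :
    π (yMonomial k hi N) ∈ ySpan k r a c :=
  Submodule.subset_span ⟨i, hi, N, rfl⟩

theorem mk_Zv_pow_mem_normalSpan {j : Fin n} (hj : r ≤ (j : ℕ)) (N : ℕ) :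
    π (Zv k r a j hj) ^ (N + 1) ∈ normalSpan k r a c :=
  Submodule.subset_span (Or.inr ⟨j, N, by rw [normalMonomial, dif_neg (not_lt.mpr hj), map_pow]⟩)

theorem ySpan_le_normalSpan : ySpan k r a c ≤ normalSpan k r a c := by
  refine Submodule.span_mono ?_
  rintro _ ⟨i, hi, N, rfl⟩
  exact Or.inr ⟨i, N, by rw [normalMonomial, dif_pos hi]⟩

theorem normalSpan_induction {motive : MvPolynomial (VIdx n r a) k ⧸ relIdeal k r a c → Prop}
    {x : MvPolynomial (VIdx n r a) k ⧸ relIdeal k r a c}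
    (hx : x ∈ normalSpan k r a c) (one : motive 1)
    (y : ∀ (i : Fin n) (hi : (i : ℕ) < r) N, motive (π (yMonomial k hi N)))
    (z : ∀ (j : Fin n) (hj : r ≤ (j : ℕ)) N, motive (π (Zv k r a j hj) ^ (N + 1)))
    (zero : motive 0) (add : ∀ x y, motive x → motive y → motive (x + y))
    (smul : ∀ (t : k) x, motive x → motive (t • x)) : motive x := by
  induction hx using Submodule.span_induction with
  | mem x hx =>
    obtain rfl | ⟨i, N, rfl⟩ := hx
    · exact one
    · rw [normalMonomial]
      split_ifs with hi
      · exact y i hi N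
      · rw [map_pow]
        exact z i (not_lt.mp hi) N
  | zero => exact zero
  | add x y _ _ hx hy => exact add x y hx hy
  | smul t x _ hx => exact smul t x hx

theorem mul_mk_Zv_mem_ySpan {j : Fin n} (hj : r ≤ (j : ℕ))
    {x : MvPolynomial (VIdx n r a) k ⧸ relIdeal k r a c} (hx : x ∈ ySpan k r a c) :
    x * π (Zv k r a j hj) ∈ ySpan k r a c := by
  induction hx using Submodule.span_induction with
  | mem x hx =>
    obtain ⟨i, hi, N, rfl⟩ := hx
    rw [mk_yMonomial_mul_Zv]
    exact sum_mem fun p _ => Submodule.smul_mem _ _ (mk_yMonomial_mem_ySpan hi _)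
  | zero => rw [zero_mul]; exact zero_mem _
  | add x y _ _ hx hy => rw [add_mul]; exact add_mem hx hy
  | smul t x _ hx => rw [smul_mul_assoc]; exact Submodule.smul_mem _ _ hx

theorem mul_mk_Zv_pow_mem_ySpan {j : Fin n} (hj : r ≤ (j : ℕ)) (N : ℕ)
    {x : MvPolynomial (VIdx n r a) k ⧸ relIdeal k r a c} (hx : x ∈ ySpan k r a c) :
    x * π (Zv k r a j hj) ^ N ∈ ySpan k r a c := by
  induction N with
  | zero => simpa using hx
  | succ N ih =>
    rw [pow_succ, ← mul_assoc]
    exact mul_mk_Zv_mem_ySpan hj ih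

theorem mk_Zv_mul_mk_Zv_mem_ySpan_of_lt {j j' : Fin n} (hj : r ≤ (j : ℕ)) (hj' : r ≤ (j' : ℕ))
    (h : (j : ℕ) < j') : π (Zv k r a j hj) * π (Zv k r a j' hj') ∈ ySpan k r a c := by
  have key := mk_eq_of_sub_mem (a := a) (c := c) (Or.inr ⟨j, j', hj, hj', h, rfl⟩)
  rw [← map_mul, key]
  simp only [map_sum, Hmon_eq_yMonomial]
  refine sum_mem fun i _ => sum_mem fun p _ => sum_mem fun p' _ => ?_
  split_ifs
  · rw [← MvPolynomial.C_mul, ← MvPolynomial.smul_eq_C_mul, map_smul]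
    exact Submodule.smul_mem _ _ (mk_yMonomial_mem_ySpan _ _)
  · rw [map_zero]
    exact zero_mem _

theorem mk_Zv_mul_mk_Zv_mem_ySpan {j j' : Fin n} (hj : r ≤ (j : ℕ)) (hj' : r ≤ (j' : ℕ))
    (h : j ≠ j') : π (Zv k r a j hj) * π (Zv k r a j' hj') ∈ ySpan k r a c := by
  obtain h | h := lt_or_gt_of_ne (Fin.val_ne_of_ne h)
  · exact mk_Zv_mul_mk_Zv_mem_ySpan_of_lt hj hj' h
  · rw [mul_comm]
    exact mk_Zv_mul_mk_Zv_mem_ySpan_of_lt hj' hj h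

theorem mul_mk_yMonomial_mem_normalSpan {i : Fin n} (hi : (i : ℕ) < r) (m : ℕ)
    {x : MvPolynomial (VIdx n r a) k ⧸ relIdeal k r a c} (hx : x ∈ normalSpan k r a c) :
    x * π (yMonomial k hi m) ∈ normalSpan k r a c := by
  refine normalSpan_induction
    (motive := fun x => x * π (yMonomial k hi m) ∈ normalSpan k r a c) hx ?_ ?_ ?_ ?_ ?_ ?_
  · rw [one_mul]
    exact ySpan_le_normalSpan (mk_yMonomial_mem_ySpan hi m)
  · intro i' hi' N
    obtain rfl | hii := eq_or_ne i' i
    · rw [mk_yMonomial_mul]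
      exact ySpan_le_normalSpan (mk_yMonomial_mem_ySpan hi _)
    · rw [mk_yMonomial_mul_of_ne hi' hi hii]
      exact zero_mem _
  · intro j hj N
    rw [mul_comm]
    exact ySpan_le_normalSpan (mul_mk_Zv_pow_mem_ySpan hj _ (mk_yMonomial_mem_ySpan hi m))
  · rw [zero_mul]
    exact zero_mem _
  · intro x y hx hy
    rw [add_mul]
    exact add_mem hx hy
  · intro t x hx
    rw [smul_mul_assoc]
    exact Submodule.smul_mem _ _ hx

theorem mul_mk_Zv_mem_normalSpan {j : Fin n} (hj : r ≤ (j : ℕ))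
    {x : MvPolynomial (VIdx n r a) k ⧸ relIdeal k r a c} (hx : x ∈ normalSpan k r a c) :
    x * π (Zv k r a j hj) ∈ normalSpan k r a c := by
  refine normalSpan_induction (motive := fun x => x * π (Zv k r a j hj) ∈ normalSpan k r a c) hx
    ?_ ?_ ?_ ?_ ?_ ?_
  · simpa using mk_Zv_pow_mem_normalSpan (c := c) hj 0
  · intro i hi N
    exact ySpan_le_normalSpan (mul_mk_Zv_mem_ySpan hj (mk_yMonomial_mem_ySpan hi N))
  · intro j' hj' N
    obtain rfl | hjj := eq_or_ne j' j
    · rw [← pow_succ]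
      exact mk_Zv_pow_mem_normalSpan hj _
    · rw [mul_comm, pow_succ', ← mul_assoc]
      exact ySpan_le_normalSpan
        (mul_mk_Zv_pow_mem_ySpan hj' N (mk_Zv_mul_mk_Zv_mem_ySpan hj hj' hjj.symm))
  · rw [zero_mul]
    exact zero_mem _
  · intro x y hx hy
    rw [add_mul]
    exact add_mem hx hy
  · intro t x hx
    rw [smul_mul_assoc]
    exact Submodule.smul_mem _ _ hx

theorem mk_mem_normalSpan (f : MvPolynomial (VIdx n r a) k) : π f ∈ normalSpan k r a c := by
  induction f using MvPolynomial.induction_on with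
  | C t =>
    rw [← MvPolynomial.algebraMap_eq, AlgHom.commutes, Algebra.algebraMap_eq_smul_one]
    exact Submodule.smul_mem _ _ (Submodule.subset_span (Or.inl rfl))
  | add f g hf hg => rw [map_add]; exact add_mem hf hg
  | mul_X f v hf =>
    rw [map_mul]
    obtain ⟨⟨i, m⟩, hi, hm⟩ | ⟨j, hj⟩ := v
    · have := mul_mk_yMonomial_mem_normalSpan hi m hf
      rwa [← Yv_eq_yMonomial hi hm] at this
    · exact mul_mk_Zv_mem_normalSpan hj hf

variable (c) in
theorem exists_normal_form (f : MvPolynomial (VIdx n r a) k) :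
    ∃ (ct : k) (p : Fin n → k[X]),
      f - (MvPolynomial.C ct + ∑ i, normalSum k r a i (p i)) ∈ relIdeal k r a c := by
  suffices h : ∀ x ∈ normalSpan k r a c, ∃ (ct : k) (p : Fin n → k[X]),
      x = π (MvPolynomial.C ct + ∑ i, normalSum k r a i (p i)) from
    (h (π f) (mk_mem_normalSpan f)).imp fun _ => Exists.imp fun _ hp => Ideal.Quotient.eq.mp hp
  intro x hx
  induction hx using Submodule.span_induction with
  | mem x hx =>
    obtain rfl | ⟨i, N, rfl⟩ := hx
    · exact ⟨1, 0, by simp⟩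
    · refine ⟨0, Pi.single i (monomial N 1), ?_⟩
      rw [Finset.sum_eq_single i]
      · simp
      · intro l _ hl
        simp [hl]
      · simp
  | zero => exact ⟨0, 0, by simp⟩
  | add x y _ _ hx hy =>
    obtain ⟨s, p, rfl⟩ := hx
    obtain ⟨t, q, rfl⟩ := hy
    refine ⟨s + t, p + q, ?_⟩
    simp only [Pi.add_apply, map_add, Finset.sum_add_distrib]
    ring
  | smul t x _ hx =>
    obtain ⟨s, p, rfl⟩ := hx
    refine ⟨t * s, t • p, ?_⟩
    rw [← map_smul, smul_add, Finset.smul_sum, MvPolynomial.smul_eq_C_mul (MvPolynomial.C s) t,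
      MvPolynomial.C_mul]
    simp only [Pi.smul_apply, map_smul]

end SpecialCurve

/-- With the notation above (and the hypotheses of Proposition 2.3
of the paper), the image of `Φ` is `A(h̄)` and the kernel of `Φ` is the ideal generated
by the relations (R1)–(R4). -/
theorem PhiMap_range_and_kernel (k : Type*) [Field k] (n r : ℕ) (hn : 1 ≤ n)
    (hr1 : 1 ≤ r) (hrn : r ≤ n) (a : Fin n → ℕ)
    (ha1 : ∀ i : Fin n, (i : ℕ) < r → 1 ≤ a i)
    (ha0 : ∀ i : Fin n, r ≤ (i : ℕ) → a i = 0)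
    (c : Fin n → Fin n → ℕ → k)
    (hprod : ∀ j j' : Fin n, r ≤ (j : ℕ) → r ≤ (j' : ℕ) → j ≠ j' →
      ∀ i : Fin n, (i : ℕ) < r →
        Polynomial.X ^ (a i + 1) ∣ hbarPoly k a c j i * hbarPoly k a c j' i) :
    (PhiMap k r a c).range = Ahbar k r a c ∧
    RingHom.ker (PhiMap k r a c) =
      Ideal.span (Rel1 k r a ∪ Rel2 k r a ∪ Rel3 k r a c ∪ Rel4 k r a c) := by
  have hle := relIdeal_le_ker hprod
  refine ⟨PhiMap_range r a c, le_antisymm (fun f hf => ?_) hle⟩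
  obtain ⟨ct, p, hp⟩ := exists_normal_form c f
  have h0 : PhiMap k r a c (MvPolynomial.C ct + ∑ i, normalSum k r a i (p i)) = 0 := by
    have h1 := RingHom.mem_ker.mp (hle hp)
    rwa [map_sub, RingHom.mem_ker.mp hf, zero_sub, neg_eq_zero] at h1
  obtain ⟨rfl, rfl⟩ := eq_zero_of_PhiMap_normal_eq_zero hr1 hrn ct p h0
  simp only [Pi.zero_apply, map_zero, Finset.sum_const_zero, add_zero, sub_zero] at hp
  exact hp
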